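/- arXiv:0912.5469 — 4 statements merged into one kernel-verified Lean document; each statement's English description precedes it below -/
import Mathlib

section
/- Let X be a sober topological space and let (Q_j)_{j ∈ J} be a nonempty filtered family of compact saturated subsets of X (filtered means: for all i, j ∈ J there exists k ∈ J with Q_k ⊆ Q_i ∩ Q_j). Then the intersection ⋂_{j ∈ J} Q_j is compact saturated. -/
open TopologicalSpace Set

/-- A subset of a topological space is saturated if it is an intersection of open sets. -/
def IsSaturatedSet {X : Type*} [TopologicalSpace X] (A : Set X) : Prop :=
  ∃ 𝒰 : Set (Set X), (∀ U ∈ 𝒰, IsOpen U) ∧ A = ⋂₀ 𝒰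

theorem IsSaturatedSet.mem_of_specializes {X : Type*} [TopologicalSpace X] {A : Set X}
    (hA : IsSaturatedSet A) {x y : X} (hxy : x ⤳ y) (hy : y ∈ A) : x ∈ A := by
  obtain ⟨𝒰, hU, rfl⟩ := hA
  exact fun U hUm ↦ hxy.mem_open (hU U hUm) (hy U hUm)

theorem IsSaturatedSet.iInter {X J : Type*} [TopologicalSpace X] {Q : J → Set X}
    (hQ : ∀ j, IsSaturatedSet (Q j)) : IsSaturatedSet (⋂ j, Q j) := by
  choose 𝒰 hU hQU using hQ
  refine ⟨⋃ j, 𝒰 j, fun U hUm ↦ ?_, ?_⟩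
  · obtain ⟨j, hj⟩ := mem_iUnion.1 hUm
    exact hU j U hj
  · rw [sInter_iUnion]
    exact iInter_congr hQU

/-- If a closed set meets every member of a filtered family of compact sets, then it contains an
irreducible closed set with this property. -/
theorem exists_isIrreducible_isClosed_forall_inter_nonempty {X J : Type*} [TopologicalSpace X]
    [Nonempty J] {Q : J → Set X} (hfil : ∀ i j : J, ∃ k : J, Q k ⊆ Q i ∩ Q j)
    (hQ : ∀ j, IsCompact (Q j)) {C : Set X} (hC : IsClosed C) (hCQ : ∀ j, (Q j ∩ C).Nonempty) :
    ∃ M ⊆ C, IsIrreducible M ∧ IsClosed M ∧ ∀ j, (Q j ∩ M).Nonempty := by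
  obtain ⟨M, hMC, hM⟩ := zorn_superset_nonempty {D : Set X | IsClosed D ∧ ∀ j, (Q j ∩ D).Nonempty}
    (fun c hc hchain hne ↦ by
      have : Nonempty c := hne.to_subtype
      refine ⟨⋂ D : c, (D : Set X), ⟨isClosed_iInter fun D ↦ (hc D.2).1, fun j ↦ ?_⟩,
        fun s hs ↦ iInter_subset (fun D : c ↦ (D : Set X)) ⟨s, hs⟩⟩
      rw [nonempty_iff_ne_empty]
      intro hempty
      obtain ⟨D, hD⟩ := (hQ j).elim_directed_family_closed (fun D : c ↦ (D : Set X))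
        (fun D ↦ (hc D.2).1) hempty
        (fun D E ↦ (hchain.total D.2 E.2).elim
          (fun h ↦ ⟨D, Subset.rfl, h⟩) (fun h ↦ ⟨E, h, Subset.rfl⟩))
      exact ((hc D.2).2 j).ne_empty hD)
    C ⟨hC, hCQ⟩
  obtain ⟨hMcl, hMQ⟩ := hM.prop
  have hsub : ∀ Z, IsClosed Z → (∀ j, (Q j ∩ (M ∩ Z)).Nonempty) → M ⊆ Z := fun Z hZ hne ↦
    (hM.le_of_le ⟨hMcl.inter hZ, hne⟩ inter_subset_left).trans inter_subset_right
  refine ⟨M, hMC, ⟨(hMQ (Classical.arbitrary J)).mono inter_subset_right, ?_⟩, hMcl, hMQ⟩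
  rw [isPreirreducible_iff_isClosed_union_isClosed]
  intro A B hA hB hAB
  by_contra! h
  have hi : ∃ i, ¬ (Q i ∩ (M ∩ A)).Nonempty := by
    by_contra! h'
    exact h.1 (hsub A hA h')
  have hj : ∃ j, ¬ (Q j ∩ (M ∩ B)).Nonempty := by
    by_contra! h'
    exact h.2 (hsub B hB h')
  obtain ⟨i, hi⟩ := hi
  obtain ⟨j, hj⟩ := hj
  obtain ⟨k, hk⟩ := hfil i j
  obtain ⟨x, hxk, hxM⟩ := hMQ k
  rcases hAB hxM with hx | hx
  · exact hi ⟨x, (hk hxk).1, hxM, hx⟩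
  · exact hj ⟨x, (hk hxk).2, hxM, hx⟩

/-- Quasisober spaces are well-filtered. -/
theorem exists_subset_of_iInter_subset_isOpen {X J : Type*} [TopologicalSpace X] [QuasiSober X]
    [Nonempty J] {Q : J → Set X} (hfil : ∀ i j : J, ∃ k : J, Q k ⊆ Q i ∩ Q j)
    (hQ : ∀ j, IsCompact (Q j)) (hsat : ∀ j, IsSaturatedSet (Q j)) {U : Set X} (hU : IsOpen U)
    (hQU : ⋂ j, Q j ⊆ U) : ∃ j, Q j ⊆ U := by
  by_contra! h
  obtain ⟨M, hMU, hMirr, hMcl, hMQ⟩ := exists_isIrreducible_isClosed_forall_inter_nonempty hfil hQ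
    hU.isClosed_compl fun j ↦ inter_compl_nonempty_iff.2 (h j)
  obtain ⟨x, hx⟩ := QuasiSober.sober hMirr hMcl
  refine hMU hx.mem (hQU (mem_iInter.2 fun j ↦ ?_))
  obtain ⟨y, hyQ, hyM⟩ := hMQ j
  exact (hsat j).mem_of_specializes (hx.specializes hyM) hyQ

/-- In a sober space, the intersection of a nonempty filtered family of compact
saturated subsets is compact saturated. -/
theorem compactSaturated_iInter {X : Type*} [TopologicalSpace X] [T0Space X] [QuasiSober X]
    {J : Type*} [Nonempty J] (Q : J → Set X)
    (hfil : ∀ i j : J, ∃ k : J, Q k ⊆ Q i ∩ Q j)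
    (hQ : ∀ j : J, IsCompact (Q j) ∧ IsSaturatedSet (Q j)) :
    IsCompact (⋂ j, Q j) ∧ IsSaturatedSet (⋂ j, Q j) := by
  refine ⟨isCompact_of_finite_subcover fun U hU hQU ↦ ?_, .iInter fun j ↦ (hQ j).2⟩
  obtain ⟨j, hj⟩ := exists_subset_of_iInter_subset_isOpen hfil (fun j ↦ (hQ j).1)
    (fun j ↦ (hQ j).2) (isOpen_iUnion hU) hQU
  obtain ⟨t, ht⟩ := (hQ j).1.elim_finite_subcover U hU hj
  exact ⟨t, (iInter_subset Q j).trans ht⟩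
end

section
/- Let X be a topological space with sobrification map ξ : X → S, ξ(x) = closure({x}), and let (A_j)_{j ∈ J} be a nonempty family of 0-closed subsets of X. Then ξ(⋂_{j ∈ J} A_j) = ⋂_{j ∈ J} ξ(A_j). -/
open TopologicalSpace Set

/-- The sobrification of a topological space `X`: the set of irreducible closed
subsets of `X`. -/
def Sobrification (X : Type*) [TopologicalSpace X] : Type _ :=
  {C : Set X // IsIrreducible C ∧ IsClosed C}

/-- For an open set `U ⊆ X`, the set `Û = {C ∈ S : C ∩ U ≠ ∅}`. -/
def hatSet {X : Type*} [TopologicalSpace X] (U : Set X) : Set (Sobrification X) :=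
  {C | (C.1 ∩ U).Nonempty}

/-- The topology on the sobrification, whose open sets are the sets `Û` for `U` open. -/
instance {X : Type*} [TopologicalSpace X] : TopologicalSpace (Sobrification X) :=
  TopologicalSpace.generateFrom {s | ∃ U : Set X, IsOpen U ∧ s = hatSet U}

/-- The sobrification map `ξ : X → S`, sending `x` to the closure of `{x}`. -/
def sobrMap {X : Type*} [TopologicalSpace X] (x : X) : Sobrification X :=
  ⟨closure {x}, isIrreducible_singleton.closure, isClosed_closure⟩

/-- A subset `A` of `X` is `0`-closed if whenever `x ∈ A` and `y` has the same
closure as `x`, then `y ∈ A`. -/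
def IsZeroClosed {X : Type*} [TopologicalSpace X] (A : Set X) : Prop :=
  ∀ x ∈ A, ∀ y : X, closure {y} = closure ({x} : Set X) → y ∈ A

/-- The class `R(X)` of `0`-closed subsets whose image under the sobrification map
is compact saturated in the sobrification. -/
def RClass (X : Type*) [TopologicalSpace X] : Set (Set X) :=
  {R | IsZeroClosed R ∧ IsCompact (sobrMap '' R) ∧ IsSaturatedSet (sobrMap '' R)}

/-- For a closed set `F ⊆ X`, the set `τ(F) = {C ∈ S : C ⊆ F}`. -/
def tauSet {X : Type*} [TopologicalSpace X] (F : Set X) : Set (Sobrification X) :=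
  {C | C.1 ⊆ F}

/-- For a nonempty family of `0`-closed subsets, `ξ(⋂ⱼ Aⱼ) = ⋂ⱼ ξ(Aⱼ)`. -/
theorem sobrMap_image_iInter (X : Type*) [TopologicalSpace X]
    {J : Type*} [Nonempty J] (A : J → Set X) (hA : ∀ j, IsZeroClosed (A j)) :
    (sobrMap : X → Sobrification X) '' (⋂ j, A j) = ⋂ j, sobrMap '' (A j) := by
  refine Subset.antisymm (image_iInter_subset _ _) fun C hC => ?_
  rw [mem_iInter] at hC
  obtain ⟨x, -, rfl⟩ := hC (Classical.arbitrary J)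
  refine ⟨x, mem_iInter.2 fun j => ?_, rfl⟩
  obtain ⟨y, hy, hyx⟩ := hC j
  exact hA j y hy x (congrArg Subtype.val hyx).symm
end

section
/- Let X be a topological space with sobrification S and sobrification map ξ : X → S, ξ(x) = closure({x}). If R ⊆ X is 0-closed and ξ(R) is compact saturated in S, then R is compact saturated in X. -/
open TopologicalSpace Set

theorem sobrMap_preimage_hatSet {X : Type*} [TopologicalSpace X] {U : Set X} (hU : IsOpen U) :
    sobrMap ⁻¹' hatSet U = U := by
  ext x
  change (closure {x} ∩ U).Nonempty ↔ x ∈ U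
  rw [closure_inter_open_nonempty_iff hU, Set.singleton_inter_nonempty]

theorem isInducing_sobrMap {X : Type*} [TopologicalSpace X] :
    Topology.IsInducing (sobrMap : X → Sobrification X) := by
  have hcont : Continuous (sobrMap : X → Sobrification X) := by
    refine continuous_generateFrom_iff.2 ?_
    rintro _ ⟨U, hU, rfl⟩
    rwa [sobrMap_preimage_hatSet hU]
  refine ⟨le_antisymm hcont.le_induced fun U hU => ?_⟩
  exact ⟨hatSet U, .basic _ ⟨U, hU, rfl⟩, sobrMap_preimage_hatSet hU⟩

theorem IsSaturatedSet.preimage {X Y : Type*} [TopologicalSpace X] [TopologicalSpace Y]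
    {f : X → Y} {A : Set Y} (hA : IsSaturatedSet A) (hf : Continuous f) :
    IsSaturatedSet (f ⁻¹' A) := by
  obtain ⟨𝒰, h𝒰, rfl⟩ := hA
  refine ⟨Set.preimage f '' 𝒰, ?_, ?_⟩
  · rintro _ ⟨U, hU, rfl⟩
    exact (h𝒰 U hU).preimage hf
  · rw [Set.preimage_sInter, Set.sInter_image]

theorem IsZeroClosed.preimage_image_sobrMap {X : Type*} [TopologicalSpace X] {A : Set X}
    (hA : IsZeroClosed A) : sobrMap ⁻¹' (sobrMap '' A) = A := by
  refine Set.Subset.antisymm ?_ (Set.subset_preimage_image _ _)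
  rintro y ⟨x, hx, hxy⟩
  exact hA x hx y (congrArg Subtype.val hxy).symm

/-- If `R ⊆ X` is `0`-closed and `ξ(R)` is compact saturated in the sobrification `S`,
then `R` is compact saturated in `X`. -/
theorem compactSaturated_of_RClass (X : Type*) [TopologicalSpace X]
    (R : Set X) (hR : IsZeroClosed R)
    (hcomp : IsCompact ((sobrMap : X → Sobrification X) '' R))
    (hsat : IsSaturatedSet ((sobrMap : X → Sobrification X) '' R)) :
    IsCompact R ∧ IsSaturatedSet R := by
  refine ⟨isInducing_sobrMap.isCompact_iff.2 hcomp, ?_⟩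
  rw [← hR.preimage_image_sobrMap]
  exact hsat.preimage isInducing_sobrMap.continuous
end

section
/- Let X be a topological space with sobrification S and sobrification map ξ : X → S, ξ(x) = closure({x}). Then X is quasisober if and only if the image ξ(X) is a saturated subset of S. -/
open TopologicalSpace Set

/-- Open subsets of the sobrification are upward closed with respect to inclusion. -/
theorem Sobrification.mem_of_subset_of_isOpen {X : Type*} [TopologicalSpace X]
    {U : Set (Sobrification X)} (hU : IsOpen U) {C D : Sobrification X} (hDC : D.1 ⊆ C.1)
    (hD : D ∈ U) : C ∈ U := by
  induction hU with
  | basic s hs =>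
    obtain ⟨V, -, rfl⟩ := hs
    exact Set.Nonempty.mono (inter_subset_inter_left V hDC) hD
  | univ => trivial
  | inter s t _ _ ihs iht => exact ⟨ihs hD.1, iht hD.2⟩
  | sUnion S _ ih =>
    obtain ⟨s, hs, hDs⟩ := hD
    exact ⟨s, hs, ih s hs hDs⟩

theorem quasiSober_iff_surjective_sobrMap (X : Type*) [TopologicalSpace X] :
    QuasiSober X ↔ Function.Surjective (sobrMap : X → Sobrification X) := by
  constructor
  · rintro ⟨h⟩ ⟨C, hC, hC'⟩
    obtain ⟨x, hx⟩ := h hC hC'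
    exact ⟨x, Subtype.ext hx⟩
  · refine fun h => ⟨fun {C} hC hC' => ?_⟩
    obtain ⟨x, hx⟩ := h ⟨C, hC, hC'⟩
    exact ⟨x, congrArg Subtype.val hx⟩

/-- `X` is quasisober if and only if the image of the sobrification map is a saturated
subset of the sobrification. -/
theorem quasiSober_iff_range_saturated (X : Type*) [TopologicalSpace X] :
    QuasiSober X ↔ IsSaturatedSet (Set.range (sobrMap : X → Sobrification X)) := by
  rw [quasiSober_iff_surjective_sobrMap]
  constructor
  · intro h
    exact ⟨∅, by simp, by rw [h.range_eq, sInter_empty]⟩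
  · rintro ⟨𝒰, h𝒰, hrange⟩ C
    obtain ⟨x, hx⟩ := C.2.1.nonempty
    have hxC : (sobrMap x).1 ⊆ C.1 := closure_minimal (singleton_subset_iff.2 hx) C.2.2
    have hmem : sobrMap x ∈ ⋂₀ 𝒰 := hrange ▸ mem_range_self x
    have hC : C ∈ ⋂₀ 𝒰 := fun U hU =>
      Sobrification.mem_of_subset_of_isOpen (h𝒰 U hU) hxC (hmem U hU)
    rwa [← hrange] at hC
end
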